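/- The Robinson polynomial R = x₀⁶ − x₀⁴x₁² − x₀²x₁⁴ + x₁⁶ − x₀⁴x₂² + 3x₀²x₁²x₂² − x₁⁴x₂² − x₀²x₂⁴ − x₁²x₂⁴ + x₂⁶ does not have a positive quadratic representation: there is no symmetric 3×3 matrix M whose entries are real homogeneous polynomials of degree two in x₀, x₁, x₂ such that det(M) = R and the real matrix M(a) is positive semidefinite for every a ∈ ℝ³. -/

import Mathlib

open MvPolynomial

noncomputable section

/-- The Robinson polynomial
`R = x₀⁶ − x₀⁴x₁² − x₀²x₁⁴ + x₁⁶ − x₀⁴x₂² + 3x₀²x₁²x₂² − x₁⁴x₂² − x₀²x₂⁴ − x₁²x₂⁴ + x₂⁶`. -/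
def Robinson : MvPolynomial (Fin 3) ℝ :=
  X 0 ^ 6 - X 0 ^ 4 * X 1 ^ 2 - X 0 ^ 2 * X 1 ^ 4 + X 1 ^ 6 - X 0 ^ 4 * X 2 ^ 2
    + 3 * X 0 ^ 2 * X 1 ^ 2 * X 2 ^ 2 - X 1 ^ 4 * X 2 ^ 2 - X 0 ^ 2 * X 2 ^ 4
    - X 1 ^ 2 * X 2 ^ 4 + X 2 ^ 6

open scoped Matrix

/-- The cubic map whose restriction to the conic `z₀² + z₁² + z₂² = 0` parametrizes the curve
cut out by the Robinson polynomial. -/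
def conicMap {K : Type*} [CommRing K] (z : Fin 3 → K) : Fin 3 → K :=
  ![z 0 * (z 1 ^ 2 - z 2 ^ 2), z 1 * (z 2 ^ 2 - z 0 ^ 2), z 2 * (z 0 ^ 2 - z 1 ^ 2)]

/-- Isotropic vectors for the standard bilinear form in three variables. -/
def IsIsotropic {K : Type*} [CommRing K] (z : Fin 3 → K) : Prop :=
  z 0 ^ 2 + z 1 ^ 2 + z 2 ^ 2 = 0

/-- The ten real zeros of the Robinson polynomial. -/
def node (k : Fin 10) : Fin 3 → ℝ :=
  ![![1, 1, 1], ![1, 1, -1], ![1, -1, 1], ![1, -1, -1], ![1, 1, 0], ![1, -1, 0], ![1, 0, 1],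
    ![1, 0, -1], ![0, 1, 1], ![0, 1, -1]] k

/-- The node `node k` as a complex vector. -/
def cnode (k : Fin 10) : Fin 3 → ℂ := fun i => (node k i : ℂ)

theorem IsIsotropic.aeval_robinson {K : Type*} [CommRing K] [Algebra ℝ K] {z : Fin 3 → K}
    (hz : IsIsotropic z) : aeval (conicMap z) Robinson = 0 := by
  unfold IsIsotropic at hz
  have h : z 2 ^ 2 = -z 0 ^ 2 - z 1 ^ 2 := by linear_combination hz
  have h4 : z 2 ^ 4 = (z 2 ^ 2) ^ 2 := by ring
  simp only [Robinson, conicMap, map_add, map_sub, map_mul, map_pow, aeval_X, map_ofNat,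
    Matrix.cons_val_zero, Matrix.cons_val_one, Matrix.cons_val, mul_pow]
  simp only [h, h4, show z 2 ^ 6 = (z 2 ^ 2) ^ 3 by ring]
  ring

theorem IsIsotropic.conicMap_sq_sum {K : Type*} [CommRing K] {z : Fin 3 → K}
    (hz : IsIsotropic z) :
    conicMap z 0 ^ 2 + conicMap z 1 ^ 2 + conicMap z 2 ^ 2 = -9 * (z 0 * z 1 * z 2) ^ 2 := by
  unfold IsIsotropic at hz
  have h : z 2 ^ 2 = -z 0 ^ 2 - z 1 ^ 2 := by linear_combination hz
  simp only [conicMap, Matrix.cons_val_zero, Matrix.cons_val_one, Matrix.cons_val, mul_pow]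
  simp only [h]
  ring

theorem conicMap_smul {K : Type*} [CommRing K] (r : K) (z : Fin 3 → K) :
    conicMap (r • z) = r ^ 3 • conicMap z := by
  ext i
  fin_cases i <;> simp [conicMap] <;> ring

theorem conicMap_star (z : Fin 3 → ℂ) : conicMap (star z) = star (conicMap z) := by
  ext i
  fin_cases i <;> simp [conicMap]

theorem IsIsotropic.conicMap_ne_zero {K : Type*} [Field K] [CharZero K] {z : Fin 3 → K}
    (hz : IsIsotropic z) (h0 : z ≠ 0) : conicMap z ≠ 0 := by
  intro h
  unfold IsIsotropic at hz
  have e0 := congrFun h 0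
  have e1 := congrFun h 1
  have e2 := congrFun h 2
  simp [conicMap, sub_eq_zero] at e0 e1 e2
  apply h0
  ext i
  fin_cases i <;> simp <;> grind

/-- A point of the conic on the polar line of a node is mapped to that node. -/
theorem IsIsotropic.conicMap_eq_smul_node {z : Fin 3 → ℂ} (hz : IsIsotropic z) (k : Fin 10)
    (hk : cnode k ⬝ᵥ z = 0) : ∃ θ : ℂ, conicMap z = θ • cnode k := by
  unfold IsIsotropic at hz
  refine ⟨if k = 8 ∨ k = 9 then conicMap z 1 else conicMap z 0, ?_⟩
  fin_cases k <;> ext i <;> fin_cases i <;>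
    simp [cnode, node, dotProduct, Fin.sum_univ_three, conicMap] at hk ⊢ <;> grind

/-- On the conic, the cofactor of `2 x₀` in the `x₀`-derivative of the Robinson polynomial
factors through the polar lines of the nodes. -/
theorem robinson_partial_factor {K : Type*} [CommRing K] {a b c : K} (h : a + b + c = 0)
    {x y z : K} (hx : x = a * (b - c) ^ 2) (hy : y = b * (c - a) ^ 2)
    (hz : z = c * (a - b) ^ 2) :
    3 * x ^ 2 - 2 * x * y - 2 * x * z - y ^ 2 - z ^ 2 + 3 * y * z
      = (a - b) * (a - c) * (a * b + b * c + c * a) * (5 * b * c - 2 * a ^ 2) := by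
  obtain rfl : c = -a - b := by linear_combination h
  subst hx hy hz
  ring

theorem dual_curve_ne_zero {u v w : ℂ} (h : u ^ 2 + v ^ 2 + w ^ 2 = 0)
    (h0 : u * (5 * v ^ 2 * w ^ 2 - 2 * (u ^ 2) ^ 2) = 0)
    (h1 : v * (5 * w ^ 2 * u ^ 2 - 2 * (v ^ 2) ^ 2) = 0)
    (h2 : w * (5 * u ^ 2 * v ^ 2 - 2 * (w ^ 2) ^ 2) = 0) : u = 0 ∧ v = 0 ∧ w = 0 := by
  by_cases hu : u = 0
  · subst hu
    have : v ^ 5 = 0 := by linear_combination (-1 / 2 : ℂ) * h1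
    have : w ^ 5 = 0 := by linear_combination (-1 / 2 : ℂ) * h2
    simp_all
  by_cases hv : v = 0
  · subst hv
    have : u ^ 5 = 0 := by linear_combination (-1 / 2 : ℂ) * h0
    simp_all
  by_cases hw : w = 0
  · subst hw
    have : u ^ 5 = 0 := by linear_combination (-1 / 2 : ℂ) * h0
    simp_all
  exfalso
  have g0 := (mul_eq_zero.1 h0).resolve_left hu
  have g1 := (mul_eq_zero.1 h1).resolve_left hv
  have g2 := (mul_eq_zero.1 h2).resolve_left hw
  have e0 : 2 * (u ^ 2) ^ 2 = 5 * v ^ 2 * w ^ 2 := by linear_combination -g0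
  have e1 : 2 * (v ^ 2) ^ 2 = 5 * w ^ 2 * u ^ 2 := by linear_combination -g1
  have e2 : 2 * (w ^ 2) ^ 2 = 5 * u ^ 2 * v ^ 2 := by linear_combination -g2
  have : (u * v * w) ^ 4 = 0 := by
    have e : 2 * (u ^ 2) ^ 2 * (2 * (v ^ 2) ^ 2) * (2 * (w ^ 2) ^ 2)
        = 5 * v ^ 2 * w ^ 2 * (5 * w ^ 2 * u ^ 2) * (5 * u ^ 2 * v ^ 2) := by rw [e0, e1, e2]
    linear_combination (-1 / 117 : ℂ) * e
  simp_all

theorem exists_node_of_pderiv_eq_zero {z : Fin 3 → ℂ} (hz : IsIsotropic z) (h0 : z ≠ 0)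
    (h : ∀ i, aeval (conicMap z) (pderiv i Robinson) = 0) : ∃ k, cnode k ⬝ᵥ z = 0 := by
  by_contra! hn
  unfold IsIsotropic at hz
  have n0 := hn 0
  have n1 := hn 1
  have n2 := hn 2
  have n3 := hn 3
  have n4 := hn 4
  have n5 := hn 5
  have n6 := hn 6
  have n7 := hn 7
  have n8 := hn 8
  have n9 := hn 9
  simp [cnode, node, dotProduct, Fin.sum_univ_three] at n0 n1 n2 n3 n4 n5 n6 n7 n8 n9
  have hab : z 0 ^ 2 - z 1 ^ 2 ≠ 0 := by
    convert mul_ne_zero n4 n5 using 1; ring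
  have hac : z 0 ^ 2 - z 2 ^ 2 ≠ 0 := by
    convert mul_ne_zero n6 n7 using 1; ring
  have hbc : z 1 ^ 2 - z 2 ^ 2 ≠ 0 := by
    convert mul_ne_zero n8 n9 using 1; ring
  have hp : z 0 ^ 2 * z 1 ^ 2 + z 1 ^ 2 * z 2 ^ 2 + z 2 ^ 2 * z 0 ^ 2 ≠ 0 := by
    intro hp
    refine mul_ne_zero (mul_ne_zero n0 n1) (mul_ne_zero n2 n3) ?_
    linear_combination -4 * hp + (z 0 ^ 2 + z 1 ^ 2 + z 2 ^ 2) * hz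
  have d0 := h 0
  have d1 := h 1
  have d2 := h 2
  simp only [Robinson, map_add, map_sub, Derivation.leibniz, Derivation.leibniz_pow, pderiv_X,
    smul_eq_mul, nsmul_eq_mul, map_mul, map_pow, aeval_X, map_natCast, Pi.single_apply,
    show (3 : MvPolynomial (Fin 3) ℝ) = C 3 from rfl, pderiv_C] at d0 d1 d2
  simp at d0 d1 d2
  have k0 := robinson_partial_factor hz (x := conicMap z 0 ^ 2) (y := conicMap z 1 ^ 2)
    (z := conicMap z 2 ^ 2) (by simp [conicMap]; ring) (by simp [conicMap]; ring)
    (by simp [conicMap]; ring)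
  have k1 := robinson_partial_factor (a := z 1 ^ 2) (b := z 2 ^ 2) (c := z 0 ^ 2)
    (by linear_combination hz) (x := conicMap z 1 ^ 2) (y := conicMap z 2 ^ 2)
    (z := conicMap z 0 ^ 2) (by simp [conicMap]; ring) (by simp [conicMap]; ring)
    (by simp [conicMap]; ring)
  have k2 := robinson_partial_factor (a := z 2 ^ 2) (b := z 0 ^ 2) (c := z 1 ^ 2)
    (by linear_combination hz) (x := conicMap z 2 ^ 2) (y := conicMap z 0 ^ 2)
    (z := conicMap z 1 ^ 2) (by simp [conicMap]; ring) (by simp [conicMap]; ring)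
    (by simp [conicMap]; ring)
  have x0 : conicMap z 0 = z 0 * (z 1 ^ 2 - z 2 ^ 2) := rfl
  have x1 : conicMap z 1 = z 1 * (z 2 ^ 2 - z 0 ^ 2) := rfl
  have x2 : conicMap z 2 = z 2 * (z 0 ^ 2 - z 1 ^ 2) := rfl
  set D := (z 0 ^ 2 - z 1 ^ 2) * (z 0 ^ 2 - z 2 ^ 2) * (z 1 ^ 2 - z 2 ^ 2) *
    (z 0 ^ 2 * z 1 ^ 2 + z 1 ^ 2 * z 2 ^ 2 + z 2 ^ 2 * z 0 ^ 2) with hD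
  have hD0 : D ≠ 0 := mul_ne_zero (mul_ne_zero (mul_ne_zero hab hac) hbc) hp
  have := dual_curve_ne_zero hz (u := z 0) (v := z 1) (w := z 2)
    (mul_left_cancel₀ hD0 (by
      linear_combination (1 / 2 : ℂ) * d0 - conicMap z 0 * k0 - x0 *
        ((z 0 ^ 2 - z 1 ^ 2) * (z 0 ^ 2 - z 2 ^ 2) *
          (z 0 ^ 2 * z 1 ^ 2 + z 1 ^ 2 * z 2 ^ 2 + z 2 ^ 2 * z 0 ^ 2) *
          (5 * z 1 ^ 2 * z 2 ^ 2 - 2 * (z 0 ^ 2) ^ 2))))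
    (mul_left_cancel₀ hD0 (by
      linear_combination (1 / 2 : ℂ) * d1 - conicMap z 1 * k1 - x1 *
        ((z 1 ^ 2 - z 2 ^ 2) * (z 1 ^ 2 - z 0 ^ 2) *
          (z 0 ^ 2 * z 1 ^ 2 + z 1 ^ 2 * z 2 ^ 2 + z 2 ^ 2 * z 0 ^ 2) *
          (5 * z 2 ^ 2 * z 0 ^ 2 - 2 * (z 1 ^ 2) ^ 2))))
    (mul_left_cancel₀ hD0 (by
      linear_combination (1 / 2 : ℂ) * d2 - conicMap z 2 * k2 - x2 *
        ((z 2 ^ 2 - z 0 ^ 2) * (z 2 ^ 2 - z 1 ^ 2) *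
          (z 0 ^ 2 * z 1 ^ 2 + z 1 ^ 2 * z 2 ^ 2 + z 2 ^ 2 * z 0 ^ 2) *
          (5 * z 0 ^ 2 * z 1 ^ 2 - 2 * (z 2 ^ 2) ^ 2))))
  apply h0
  ext i
  fin_cases i <;> simp [this]

theorem Matrix.adjugate_map_apply {n R S : Type*} [Fintype n] [DecidableEq n] [CommRing R]
    [CommRing S] (N : Matrix n n R) (f : R →+* S) (i j : n) :
    f (N.adjugate i j) = (N.map f).adjugate i j :=
  congrFun₂ (f.map_adjugate N) i j

theorem eq_X_sq_mul_of_nonneg {P : Polynomial ℝ} (h : ∀ t, 0 ≤ P.eval t) (h0 : P.eval 0 = 0) :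
    ∃ Q : Polynomial ℝ, P = Polynomial.X ^ 2 * Q := by
  obtain ⟨Q, rfl⟩ := (Polynomial.dvd_iff_isRoot (a := 0)).2 h0
  have hQ : Q.eval 0 = 0 := by
    by_contra hne
    have hc : Filter.Tendsto (fun t => Q.eval t) (nhds 0) (nhds (Q.eval 0)) :=
      Q.continuous.tendsto 0
    rcases lt_or_gt_of_ne hne with hlt | hgt
    · obtain ⟨ε, hε, hb⟩ := Metric.eventually_nhds_iff.1 (hc.eventually_lt_const hlt)
      have h1 := hb (y := ε / 2) (by rw [Real.dist_eq, abs_lt]; constructor <;> linarith)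
      have h2 := h (ε / 2)
      simp at h2
      nlinarith
    · obtain ⟨ε, hε, hb⟩ := Metric.eventually_nhds_iff.1 (hc.eventually_const_lt hgt)
      have h1 := hb (y := -(ε / 2)) (by rw [Real.dist_eq, abs_lt]; constructor <;> linarith)
      have h2 := h (-(ε / 2))
      simp at h2
      nlinarith
  obtain ⟨Q', rfl⟩ := (Polynomial.dvd_iff_isRoot (a := 0)).2 hQ
  exact ⟨Q', by simp; ring⟩

theorem eval_zero_nonneg_of_X_pow_mul {P : Polynomial ℝ} (n : ℕ)
    (h : ∀ t, 0 ≤ (Polynomial.X ^ n * P).eval t) : 0 ≤ P.eval 0 := by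
  by_contra! hlt
  obtain ⟨ε, hε, hb⟩ := Metric.eventually_nhds_iff.1
    ((P.continuous.tendsto 0).eventually_lt_const hlt)
  have h1 := hb (y := ε / 2) (by rw [Real.dist_eq, abs_lt]; constructor <;> linarith)
  have h2 := h (ε / 2)
  simp at h2
  nlinarith [show 0 < (ε / 2) ^ n by positivity]

namespace Matrix.PosSemidef

variable {N : Matrix (Fin 3) (Fin 3) ℝ}

theorem adjugate_diag_nonneg (hN : N.PosSemidef) (i : Fin 3) : 0 ≤ N.adjugate i i := by
  have h : ∀ f : Fin 2 → Fin 3, 0 ≤ (N.submatrix f f).det := fun f => (hN.submatrix f).det_nonneg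
  have h0 := h ![1, 2]
  have h1 := h ![0, 2]
  have h2 := h ![0, 1]
  rw [Matrix.det_fin_two] at h0 h1 h2
  simp at h0 h1 h2
  fin_cases i <;> simp [Matrix.adjugate_fin_three] <;> linarith

theorem det_mul_le_adjugate (hN : N.PosSemidef) :
    N.det * N 2 2 ≤ N.adjugate 0 0 * N.adjugate 1 1 := by
  have h01 : N 1 0 = N 0 1 := by simpa using hN.1.apply 0 1
  have h02 : N 2 0 = N 0 2 := by simpa using hN.1.apply 0 2
  have h12 : N 2 1 = N 1 2 := by simpa using hN.1.apply 1 2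
  simp only [Matrix.adjugate_fin_three, Matrix.det_fin_three, Matrix.of_apply, Matrix.cons_val',
    Matrix.cons_val_zero, Matrix.cons_val_one, h01, h02, h12]
  nlinarith [sq_nonneg (N 0 1 * N 2 2 - N 0 2 * N 1 2)]

theorem det_le_mul_adjugate (hN : N.PosSemidef) :
    N.det ≤ N 2 2 * N.adjugate 2 2 := by
  have h01 : N 1 0 = N 0 1 := by simpa using hN.1.apply 0 1
  have h02 : N 2 0 = N 0 2 := by simpa using hN.1.apply 0 2
  have h12 : N 2 1 = N 1 2 := by simpa using hN.1.apply 1 2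
  have h := hN.re_dotProduct_nonneg ![N 1 2, -N 0 2, 0]
  simp [dotProduct, Matrix.mulVec, Fin.sum_univ_three, h01] at h
  simp [Matrix.adjugate_fin_three, Matrix.det_fin_three, h01, h02, h12]
  nlinarith

end Matrix.PosSemidef

/-- If the adjugate of a one-parameter family of positive semidefinite matrices vanishes at a
point, then the determinant vanishes there to order at least four. -/
theorem eval_zero_nonpos_of_adjugate_eq_zero {N : Matrix (Fin 3) (Fin 3) (Polynomial ℝ)}
    (hN : ∀ t, (N.map (Polynomial.eval t)).PosSemidef) {r : Polynomial ℝ}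
    (hdet : N.det = Polynomial.X ^ 2 * r)
    (hA : ∀ i, (N.adjugate i i).eval 0 = 0) : r.eval 0 ≤ 0 := by
  have hadj : ∀ t i, (N.adjugate i i).eval t = (N.map (Polynomial.eval t)).adjugate i i := by
    intro t i
    exact N.adjugate_map_apply (Polynomial.evalRingHom t) i i
  have hdet' : ∀ t, (N.map (Polynomial.eval t)).det = t ^ 2 * r.eval t := by
    intro t
    rw [← Polynomial.coe_evalRingHom, ← RingHom.mapMatrix_apply, ← RingHom.map_det, hdet]
    simp
  have hsq : ∀ i, ∃ Q, N.adjugate i i = Polynomial.X ^ 2 * Q := fun i =>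
    eq_X_sq_mul_of_nonneg (fun t => by rw [hadj]; exact (hN t).adjugate_diag_nonneg i) (hA i)
  choose Q hQ using hsq
  have key : 0 ≤ (Polynomial.X ^ 2 * Q 0 * Q 1 - r * N 2 2).eval 0 := by
    refine eval_zero_nonneg_of_X_pow_mul 2 fun t => ?_
    have := (hN t).det_mul_le_adjugate
    rw [hdet', ← hadj, ← hadj, hQ, hQ] at this
    simp at this ⊢
    linarith
  by_contra! hr
  have hm0 : ∀ t, 0 ≤ (N 2 2).eval t := fun t => (hN t).diag_nonneg (i := 2)
  have hm : (N 2 2).eval 0 = 0 := by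
    simp at key
    nlinarith [hm0 0]
  obtain ⟨μ, hμ⟩ := eq_X_sq_mul_of_nonneg hm0 hm
  have key2 : 0 ≤ (Polynomial.X ^ 2 * μ * Q 2 - r).eval 0 := by
    refine eval_zero_nonneg_of_X_pow_mul 2 fun t => ?_
    have := (hN t).det_le_mul_adjugate
    rw [hdet', ← hadj, hQ, Matrix.map_apply, hμ] at this
    simp at this ⊢
    linarith
  simp at key2
  linarith

/-- The line through the node `k` in a coordinate direction along which the Robinson polynomial
vanishes to order exactly two at the node. -/
theorem exists_line_through_node (k : Fin 10) : ∃ (d : Fin 3 → ℝ) (r : Polynomial ℝ),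
    aeval (fun i => Polynomial.C (node k i) + Polynomial.X * Polynomial.C (d i)) Robinson
      = Polynomial.X ^ 2 * r ∧ 0 < r.eval 0 := by
  refine ⟨![![1, 0, 0], ![1, 0, 0], ![1, 0, 0], ![1, 0, 0], ![0, 0, 1], ![0, 0, 1], ![0, 1, 0],
    ![0, 1, 0], ![1, 0, 0], ![1, 0, 0]] k,
    if k.1 < 4 then (1 + Polynomial.X) ^ 2 * (2 + Polynomial.X) ^ 2
    else (1 - Polynomial.X ^ 2) ^ 2, ?_, ?_⟩
  · fin_cases k <;> simp [Robinson, node] <;> ring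
  · fin_cases k <;> simp

theorem adjugate_node_ne_zero {M : Matrix (Fin 3) (Fin 3) (MvPolynomial (Fin 3) ℝ)}
    (hdet : M.det = Robinson) (hpsd : ∀ a, (M.map (eval a)).PosSemidef) (k : Fin 10) :
    ∃ i, eval (node k) (M.adjugate i i) ≠ 0 := by
  by_contra! h
  obtain ⟨d, r, hr, hpos⟩ := exists_line_through_node k
  set φ := aeval (R := ℝ) (fun i => Polynomial.C (node k i) + Polynomial.X * Polynomial.C (d i))
    with hφ
  have hev : ∀ (t : ℝ) (p : MvPolynomial (Fin 3) ℝ),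
      (φ p).eval t = eval (fun i => node k i + t * d i) p := by
    intro t p
    induction p using MvPolynomial.induction_on with
    | C a => simp [hφ]
    | add p q hp hq => simp [hp, hq]
    | mul_X p i hp =>
      rw [map_mul, Polynomial.eval_mul, hp]
      simp [hφ, -Polynomial.X_mul_C]
  refine not_lt_of_ge (eval_zero_nonpos_of_adjugate_eq_zero (N := M.map φ) (r := r)
    (fun t => ?_) ?_ ?_) hpos
  · convert hpsd (fun i => node k i + t * d i) using 1
    ext i j
    simp [hev]
  · rw [← hr, ← hdet]
    exact (AlgHom.map_det φ M).symm
  · intro i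
    refine (congrArg _ (M.adjugate_map_apply φ.toRingHom i i).symm).trans ?_
    exact (hev 0 _).trans (by simpa using h i)

theorem MvPolynomial.IsHomogeneous.degree_eq_of_mem_support {σ K : Type*} [CommRing K]
    {p : MvPolynomial σ K} {n : ℕ} (hp : p.IsHomogeneous n) {d : σ →₀ ℕ} (hd : d ∈ p.support) :
    d.degree = n := by
  rw [← hp (mem_support_iff.1 hd), Finsupp.degree_eq_weight_one]
  rfl

theorem MvPolynomial.IsHomogeneous.eval_eq_sum {K : Type*} [CommRing K]
    {p : MvPolynomial (Fin 3) K} {n : ℕ} (hp : p.IsHomogeneous n) :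
    ∃ c : ℕ → ℕ → K, ∀ x, eval x p = ∑ i ∈ Finset.range (n + 1),
      ∑ j ∈ Finset.range (n + 1 - i), c i j * x 0 ^ i * x 1 ^ j * x 2 ^ (n - i - j) := by
  refine ⟨fun i j => p.coeff (Finsupp.equivFunOnFinite.symm ![i, j, n - i - j]), fun x => ?_⟩
  rw [eval_eq', Finset.sum_sigma']
  have hdeg : ∀ d ∈ p.support, d 0 + d 1 + d 2 = n := fun d hd => by
    rw [← hp.degree_eq_of_mem_support hd, Finsupp.degree_eq_sum, Fin.sum_univ_three]
  have hd' : ∀ d ∈ p.support, Finsupp.equivFunOnFinite.symm ![d 0, d 1, n - d 0 - d 1] = d := by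
    intro d hd
    have := hdeg d hd
    ext i
    fin_cases i <;> simp <;> omega
  refine Finset.sum_of_injOn (fun d => ⟨d 0, d 1⟩) ?_ ?_ ?_ ?_
  · intro d hd e he h
    simp only [Sigma.mk.injEq, heq_eq_eq] at h
    rw [← hd' d hd, ← hd' e he, h.1, h.2]
  · intro d hd
    have := hdeg d hd
    simp
    omega
  · intro y hy hne
    have h0 : p.coeff (Finsupp.equivFunOnFinite.symm ![y.1, y.2, n - y.1 - y.2]) = 0 :=
      notMem_support_iff.1 fun hs => hne ⟨_, hs, by simp⟩
    simp only [h0, zero_mul]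
  · intro d hd
    have := hdeg d hd
    simp only [hd' d hd, Fin.prod_univ_three]
    rw [show n - d 0 - d 1 = d 2 by omega]
    ring

theorem quadratic_coeff_eq_zero {p q r s t u : ℂ}
    (h : ∀ a b c : ℂ, a + b + c = 0 → a ≠ 0 → b ≠ 0 → c ≠ 0 → b ≠ c →
      p * (a * (b - c) ^ 2) ^ 2 + q * (b * (c - a) ^ 2) ^ 2 + r * (c * (a - b) ^ 2) ^ 2
        + s * (a * (b - c) ^ 2) * (b * (c - a) ^ 2) + t * (a * (b - c) ^ 2) * (c * (a - b) ^ 2)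
        + u * (b * (c - a) ^ 2) * (c * (a - b) ^ 2) = 0) :
    p = 0 ∧ q = 0 ∧ r = 0 ∧ s = 0 ∧ t = 0 ∧ u = 0 := by
  have h1 := h 1 1 (-2) (by norm_num) (by norm_num) (by norm_num) (by norm_num) (by norm_num)
  have h2 := h 1 (-2) 1 (by norm_num) (by norm_num) (by norm_num) (by norm_num) (by norm_num)
  have h3 := h 1 2 (-3) (by norm_num) (by norm_num) (by norm_num) (by norm_num) (by norm_num)
  have h4 := h 2 1 (-3) (by norm_num) (by norm_num) (by norm_num) (by norm_num) (by norm_num)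
  have h5 := h 3 (-1) (-2) (by norm_num) (by norm_num) (by norm_num) (by norm_num) (by norm_num)
  have h6 := h 1 3 (-4) (by norm_num) (by norm_num) (by norm_num) (by norm_num) (by norm_num)
  grind

theorem linear_coeff_eq_zero {p q r : ℂ}
    (h : ∀ a b c : ℂ, a + b + c = 0 → a ≠ 0 → b ≠ 0 → c ≠ 0 → b ≠ c → c ≠ a → a ≠ b →
      p * (a * (b - c) ^ 2) + q * (b * (c - a) ^ 2) + r * (c * (a - b) ^ 2) = 0) :
    p = 0 ∧ q = 0 ∧ r = 0 := by
  have h1 := h 1 2 (-3) (by norm_num) (by norm_num) (by norm_num) (by norm_num) (by norm_num)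
    (by norm_num) (by norm_num)
  have h2 := h 1 3 (-4) (by norm_num) (by norm_num) (by norm_num) (by norm_num) (by norm_num)
    (by norm_num) (by norm_num)
  have h3 := h 2 1 (-3) (by norm_num) (by norm_num) (by norm_num) (by norm_num) (by norm_num)
    (by norm_num) (by norm_num)
  grind

/-- No nonzero quintic form vanishes on the curve cut out by the Robinson polynomial. -/
theorem eval_quintic_eq_zero {p : MvPolynomial (Fin 3) ℂ} (hp : p.IsHomogeneous 5)
    (h : ∀ z, IsIsotropic z → z 2 ≠ 0 → eval (conicMap z) p = 0) (x : Fin 3 → ℂ) :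
    eval x p = 0 := by
  obtain ⟨c, hc⟩ := hp.eval_eq_sum
  have key : ∀ a b d : ℂ, a + b + d = 0 → a ≠ 0 → b ≠ 0 → d ≠ 0 → ∃ u v w : ℂ,
      u ^ 2 = a * (b - d) ^ 2 ∧ v ^ 2 = b * (d - a) ^ 2 ∧ w ^ 2 = d * (a - b) ^ 2 ∧
      eval ![u, v, w] p = 0 ∧ eval ![-u, v, w] p = 0 ∧ eval ![u, -v, w] p = 0 ∧
      eval ![u, v, -w] p = 0 := by
    intro a b d habd ha hb hd
    obtain ⟨α, rfl⟩ := IsAlgClosed.exists_pow_nat_eq a two_pos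
    obtain ⟨β, rfl⟩ := IsAlgClosed.exists_pow_nat_eq b two_pos
    obtain ⟨γ, rfl⟩ := IsAlgClosed.exists_pow_nat_eq d two_pos
    have hγ : γ ≠ 0 := by rintro rfl; simp at hd
    have h1 := h ![α, β, γ] (by simp [IsIsotropic, habd]) (by simpa using hγ)
    have h2 := h ![-α, β, γ] (by simp [IsIsotropic, habd]) (by simpa using hγ)
    have h3 := h ![α, -β, γ] (by simp [IsIsotropic, habd]) (by simpa using hγ)
    have h4 := h ![α, β, -γ] (by simp [IsIsotropic, habd]) (by simpa using hγ)
    refine ⟨α * (β ^ 2 - γ ^ 2), β * (γ ^ 2 - α ^ 2), γ * (α ^ 2 - β ^ 2), by ring, by ring,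
      by ring, ?_, ?_, ?_, ?_⟩
    · simpa [conicMap] using h1
    · simpa [conicMap] using h2
    · simpa [conicMap] using h3
    · simpa [conicMap] using h4
  simp only [hc] at key ⊢
  simp [Finset.sum_range_succ] at key ⊢
  have split : ∀ a b d : ℂ, a + b + d = 0 → a ≠ 0 → b ≠ 0 → d ≠ 0 →
      ∃ u v w : ℂ,
      u ^ 2 = a * (b - d) ^ 2 ∧ v ^ 2 = b * (d - a) ^ 2 ∧ w ^ 2 = d * (a - b) ^ 2 ∧
      u * (c 5 0 * (u ^ 2) ^ 2 + c 1 4 * (v ^ 2) ^ 2 + c 1 0 * (w ^ 2) ^ 2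
        + c 3 2 * u ^ 2 * v ^ 2 + c 3 0 * u ^ 2 * w ^ 2 + c 1 2 * v ^ 2 * w ^ 2) = 0 ∧
      v * (c 0 5 * (v ^ 2) ^ 2 + c 0 1 * (w ^ 2) ^ 2 + c 4 1 * (u ^ 2) ^ 2
        + c 0 3 * v ^ 2 * w ^ 2 + c 2 3 * v ^ 2 * u ^ 2 + c 2 1 * w ^ 2 * u ^ 2) = 0 ∧
      w * (c 0 0 * (w ^ 2) ^ 2 + c 4 0 * (u ^ 2) ^ 2 + c 0 4 * (v ^ 2) ^ 2
        + c 2 0 * w ^ 2 * u ^ 2 + c 0 2 * w ^ 2 * v ^ 2 + c 2 2 * u ^ 2 * v ^ 2) = 0 ∧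
      u * v * w * (c 3 1 * u ^ 2 + c 1 3 * v ^ 2 + c 1 1 * w ^ 2) = 0 := by
    intro a b d habd ha hb hd
    obtain ⟨u, hu, v, hv, w, hw, h1, h2, h3, h4⟩ := key a b d habd ha hb hd
    refine ⟨u, v, w, hu, hv, hw, ?_, ?_, ?_, ?_⟩
    · linear_combination (h1 - h2 + h3 + h4) / 4
    · linear_combination (h1 + h2 - h3 + h4) / 4
    · linear_combination (h1 + h2 + h3 - h4) / 4
    · linear_combination (h1 - h2 - h3 - h4) / 4
  clear key
  have hU := quadratic_coeff_eq_zero (p := c 5 0) (q := c 1 4) (r := c 1 0) (s := c 3 2)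
    (t := c 3 0) (u := c 1 2) (fun a b d habd ha hb hd hne => by
      obtain ⟨u, v, w, hu, hv, hw, h1, -⟩ := split a b d habd ha hb hd
      rw [← hu, ← hv, ← hw]
      refine (mul_eq_zero.1 h1).resolve_left fun h0 => ?_
      simp [h0, ha, sub_eq_zero, hne] at hu)
  have hV := quadratic_coeff_eq_zero (p := c 0 5) (q := c 0 1) (r := c 4 1) (s := c 0 3)
    (t := c 2 3) (u := c 2 1) (fun b d a habd hb hd ha hne => by
      obtain ⟨u, v, w, hu, hv, hw, -, h1, -⟩ :=
        split a b d (by rw [← habd]; ring) ha hb hd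
      rw [← hu, ← hv, ← hw]
      refine (mul_eq_zero.1 h1).resolve_left fun h0 => ?_
      simp [h0, hb, sub_eq_zero, hne] at hv)
  have hW := quadratic_coeff_eq_zero (p := c 0 0) (q := c 4 0) (r := c 0 4) (s := c 2 0)
    (t := c 0 2) (u := c 2 2) (fun d a b habd hd ha hb hne => by
      obtain ⟨u, v, w, hu, hv, hw, -, -, h1, -⟩ :=
        split a b d (by rw [← habd]; ring) ha hb hd
      rw [← hu, ← hv, ← hw]
      refine (mul_eq_zero.1 h1).resolve_left fun h0 => ?_
      simp [h0, hd, sub_eq_zero, hne] at hw)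
  have hT := linear_coeff_eq_zero (p := c 3 1) (q := c 1 3) (r := c 1 1)
    (fun a b d habd ha hb hd hbd hda hab => by
      obtain ⟨u, v, w, hu, hv, hw, -, -, -, h1⟩ := split a b d habd ha hb hd
      rw [← hu, ← hv, ← hw]
      refine (mul_eq_zero.1 h1).resolve_left (mul_ne_zero (mul_ne_zero ?_ ?_) ?_) <;> rintro rfl
      · simp [ha, sub_eq_zero, hbd] at hu
      · simp [hb, sub_eq_zero, hda] at hv
      · simp [hd, sub_eq_zero, hab] at hw)
  simp [hU, hV, hW, hT]
theorem Matrix.adjugate_mul_adjugate_of_det_eq_zero {R : Type*} [CommRing R]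
    {N : Matrix (Fin 3) (Fin 3) R} (hN : N.IsSymm) (h : N.det = 0) (i j k : Fin 3) :
    N.adjugate i i * N.adjugate j k = N.adjugate i j * N.adjugate i k := by
  have h01 : N 1 0 = N 0 1 := hN.apply 0 1
  have h02 : N 2 0 = N 0 2 := hN.apply 0 2
  have h12 : N 2 1 = N 1 2 := hN.apply 1 2
  have hz : ∀ a b, N.adjugate.adjugate a b = 0 := by
    intro a b
    rw [Matrix.adjugate_adjugate' N, h]
    simp
  have hs : ∀ a b, N.adjugate a b = N.adjugate b a := fun a b => hN.adjugate.apply b a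
  rw [Matrix.adjugate_fin_three N.adjugate] at hz
  have z00 := hz 0 0
  have z01 := hz 0 1
  have z02 := hz 0 2
  have z11 := hz 1 1
  have z12 := hz 1 2
  have z22 := hz 2 2
  have s01 := hs 1 0
  have s02 := hs 2 0
  have s12 := hs 2 1
  generalize N.adjugate = A at *
  simp [s01, s02, s12] at z00 z01 z02 z11 z12 z22
  fin_cases i <;> fin_cases j <;> fin_cases k <;> simp [s01, s02, s12] <;> grind

theorem aeval_pderiv_det_eq_zero {K : Type*} [CommRing K] [Algebra ℝ K]
    (M : Matrix (Fin 3) (Fin 3) (MvPolynomial (Fin 3) ℝ)) (x : Fin 3 → K)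
    (h : ∀ i j, aeval x (M.adjugate i j) = 0) (k : Fin 3) : aeval x (pderiv k M.det) = 0 := by
  have e : pderiv k M.det = ∑ i, ∑ j, M.adjugate i j * pderiv k (M j i) := by
    rw [Matrix.det_fin_three, Matrix.adjugate_fin_three]
    simp [Fin.sum_univ_three, Derivation.leibniz]
    ring
  simp [e, h]

theorem exists_sq_eq_of_even_rootMultiplicity {P : Polynomial ℂ}
    (h : ∀ t, Even (P.rootMultiplicity t)) : ∃ v, v ^ 2 = P := by
  obtain ⟨s, hs⟩ : ∃ s : Multiset ℂ, P.roots = 2 • s := by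
    have hc : ∀ t, Even (P.roots.count t) := fun t => by rw [Polynomial.count_roots]; exact h t
    refine ⟨∑ a ∈ P.roots.toFinset, (P.roots.count a / 2) • {a}, ?_⟩
    conv_lhs => rw [← Multiset.toFinset_sum_count_nsmul_eq P.roots]
    rw [Finset.smul_sum]
    refine Finset.sum_congr rfl fun a _ => ?_
    rw [smul_smul, Nat.two_mul_div_two_of_even (hc a)]
  obtain ⟨c, hc⟩ := IsAlgClosed.exists_pow_nat_eq P.leadingCoeff two_pos
  refine ⟨Polynomial.C c * (s.map fun a => Polynomial.X - Polynomial.C a).prod, ?_⟩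
  rw [mul_pow, ← Multiset.prod_nsmul, ← Multiset.map_nsmul, ← hs, ← map_pow, hc]
  exact (IsAlgClosed.splits P).eq_prod_roots.symm

theorem MvPolynomial.IsHomogeneous.aeval_smul {R K : Type*} [CommRing R] [CommRing K]
    [Algebra R K] {p : MvPolynomial (Fin 3) R} {n : ℕ} (hp : p.IsHomogeneous n) (r : K) (x : Fin 3 → K) :
    MvPolynomial.aeval (r • x) p = r ^ n * MvPolynomial.aeval x p := by
  simp only [MvPolynomial.aeval_def, eval₂_eq', Finset.mul_sum]
  refine Finset.sum_congr rfl fun d hd => ?_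
  have hdeg : ∑ i, d i = n := by
    rw [← hp.degree_eq_of_mem_support hd, Finsupp.degree_eq_sum]
  simp only [Pi.smul_apply, smul_eq_mul, mul_pow, Finset.prod_mul_distrib,
    Finset.prod_pow_eq_pow_sum, hdeg]
  ring

theorem adjugate_isHomogeneous {R : Type*} [CommRing R]
    {M : Matrix (Fin 3) (Fin 3) (MvPolynomial (Fin 3) R)} (hM : ∀ i j, (M i j).IsHomogeneous 2)
    (i j : Fin 3) : (M.adjugate i j).IsHomogeneous 4 := by
  have h : ∀ a b c d e f g h, (M a b * M c d - M e f * M g h).IsHomogeneous 4 :=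
    fun a b c d e f g h => ((hM a b).mul (hM c d)).sub ((hM e f).mul (hM g h))
  rw [Matrix.adjugate_fin_three]
  fin_cases i <;> fin_cases j <;> simp [neg_add_eq_sub, h]

theorem aeval_star (p : MvPolynomial (Fin 3) ℝ) (x : Fin 3 → ℂ) :
    aeval (star x) p = star (aeval x p) := by
  induction p using MvPolynomial.induction_on with
  | C a => simp
  | add p q hp hq => simp [hp, hq]
  | mul_X p i hp => simp [hp]

/-- The cubic form taking the value `1` at one node and vanishing at the other nodes. -/
def nodeCubic (k : Fin 10) : MvPolynomial (Fin 3) ℂ :=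
  let T (x y z : MvPolynomial (Fin 3) ℂ) : MvPolynomial (Fin 3) ℂ :=
    C (1 / 4) * (x * y * z + x ^ 2 * (y + z) + y ^ 2 * (x + z) + z ^ 2 * (x + y)
      - x ^ 3 - y ^ 3 - z ^ 3)
  let D (x y z : MvPolynomial (Fin 3) ℂ) : MvPolynomial (Fin 3) ℂ :=
    C (1 / 2) * (x ^ 3 + y ^ 3 - z ^ 2 * (x + y))
  ![T (X 0) (X 1) (X 2), T (X 0) (X 1) (-X 2), T (X 0) (-X 1) (X 2), T (X 0) (-X 1) (-X 2),
    D (X 0) (X 1) (X 2), D (X 0) (-X 1) (X 2), D (X 0) (X 2) (X 1), D (X 0) (-X 2) (X 1),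
    D (X 1) (X 2) (X 0), D (X 1) (-X 2) (X 0)] k

theorem nodeCubic_isHomogeneous (k : Fin 10) : (nodeCubic k).IsHomogeneous 3 := by
  have hn : ∀ {p : MvPolynomial (Fin 3) ℂ}, p.IsHomogeneous 1 → (-p).IsHomogeneous 1 :=
    fun h => h.neg
  have hT : ∀ {x y z : MvPolynomial (Fin 3) ℂ}, x.IsHomogeneous 1 → y.IsHomogeneous 1 →
      z.IsHomogeneous 1 → (C (1 / 4) * (x * y * z + x ^ 2 * (y + z) + y ^ 2 * (x + z)
        + z ^ 2 * (x + y) - x ^ 3 - y ^ 3 - z ^ 3)).IsHomogeneous 3 := by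
    intro x y z hx hy hz
    refine IsHomogeneous.C_mul ?_ _
    refine ((((((((hx.mul hy).mul hz).add ((hx.pow 2).mul (hy.add hz))).add
      ((hy.pow 2).mul (hx.add hz))).add ((hz.pow 2).mul (hx.add hy))).sub (hx.pow 3)).sub
      (hy.pow 3)).sub (hz.pow 3))
  have hD : ∀ {x y z : MvPolynomial (Fin 3) ℂ}, x.IsHomogeneous 1 → y.IsHomogeneous 1 →
      z.IsHomogeneous 1 →
      (C (1 / 2) * (x ^ 3 + y ^ 3 - z ^ 2 * (x + y))).IsHomogeneous 3 := by
    intro x y z hx hy hz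
    refine IsHomogeneous.C_mul ?_ _
    exact ((hx.pow 3).add (hy.pow 3)).sub ((hz.pow 2).mul (hx.add hy))
  have h0 := isHomogeneous_X ℂ (0 : Fin 3)
  have h1 := isHomogeneous_X ℂ (1 : Fin 3)
  have h2 := isHomogeneous_X ℂ (2 : Fin 3)
  fin_cases k
  · exact hT h0 h1 h2
  · exact hT h0 h1 (hn h2)
  · exact hT h0 (hn h1) h2
  · exact hT h0 (hn h1) (hn h2)
  · exact hD h0 h1 h2
  · exact hD h0 (hn h1) h2
  · exact hD h0 h2 h1
  · exact hD h0 (hn h2) h1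
  · exact hD h1 h2 h0
  · exact hD h1 (hn h2) h0

set_option maxHeartbeats 2000000 in
theorem eval_nodeCubic (k l : Fin 10) :
    eval (cnode l) (nodeCubic k) = if k = l then 1 else 0 := by
  fin_cases k <;> fin_cases l <;> simp [nodeCubic, cnode, node] <;> norm_num

theorem aeval_cnode (p : MvPolynomial (Fin 3) ℝ) (k : Fin 10) :
    aeval (cnode k) p = (eval (node k) p : ℂ) := by
  induction p using MvPolynomial.induction_on with
  | C a => simp
  | add p q hp hq => simp [hp, hq]
  | mul_X p i hp => simp [hp, cnode]

/-- A parametrization of the conic of isotropic vectors. -/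
def conicPoint {K : Type*} [CommRing K] [Algebra ℂ K] (t : K) : Fin 3 → K :=
  ![1 - t ^ 2, algebraMap ℂ K Complex.I * (1 + t ^ 2), 2 * t]

/-- The antipodal map, which corresponds to complex conjugation under `conicPoint`. -/
def antipode (t : ℂ) : ℂ := -(star t)⁻¹

/-- The parametrization of the curve cut out by the Robinson polynomial. -/
def curvePoly : Fin 3 → Polynomial ℂ := conicMap (conicPoint Polynomial.X)

theorem conicPoint_isIsotropic {K : Type*} [CommRing K] [Algebra ℂ K] (t : K) :
    IsIsotropic (conicPoint t) := by
  have h : algebraMap ℂ K Complex.I ^ 2 = -1 := by rw [← map_pow, Complex.I_sq]; simp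
  simp only [IsIsotropic, conicPoint, Matrix.cons_val_zero, Matrix.cons_val_one, Matrix.cons_val,
    mul_pow, h]
  ring

theorem conicPoint_ne_zero (t : ℂ) : conicPoint t ≠ 0 := by
  intro h
  have h0 := congrFun h 0
  have h2 := congrFun h 2
  simp [conicPoint] at h0 h2
  simp [h2] at h0

theorem conicPoint_antipode {t : ℂ} (ht : t ≠ 0) :
    conicPoint (antipode t) = (-((star t) ^ 2)⁻¹) • star (conicPoint t) := by
  have h : starRingEnd ℂ t ≠ 0 := by simpa using ht
  ext i
  fin_cases i <;> simp [conicPoint, antipode] <;> field_simp <;> ring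

theorem IsIsotropic.exists_eq_smul_conicPoint {z : Fin 3 → ℂ} (hz : IsIsotropic z)
    (h2 : z 2 ≠ 0) : ∃ s t : ℂ, z = s • conicPoint t := by
  obtain ⟨d, hd⟩ : ∃ d, z 0 = d + Complex.I * z 1 := ⟨z 0 - Complex.I * z 1, by ring⟩
  have hI := Complex.I_sq
  have e : d * (d + 2 * Complex.I * z 1) = -z 2 ^ 2 := by
    unfold IsIsotropic at hz
    rw [hd] at hz
    linear_combination hz - z 1 ^ 2 * hI
  have hd0 : d ≠ 0 := by
    rintro rfl
    rw [zero_mul] at e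
    exact h2 (by simpa using e.symm)
  refine ⟨d / 2, z 2 / d, ?_⟩
  ext i
  fin_cases i <;> simp [conicPoint] <;> field_simp
  · linear_combination e + 2 * d * hd
  · linear_combination (-Complex.I) * e + 2 * d * z 1 * hI

theorem eval_curvePoly (t : ℂ) (i : Fin 3) :
    (curvePoly i).eval t = conicMap (conicPoint t) i := by
  fin_cases i <;> simp [curvePoly, conicMap, conicPoint]

theorem natDegree_curvePoly_le (i : Fin 3) : (curvePoly i).natDegree ≤ 6 := by
  fin_cases i <;> simp only [curvePoly, conicMap, conicPoint, ← Polynomial.C_eq_algebraMap] <;>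
    simp <;> (compute_degree; try norm_num)

theorem eval_aeval_curvePoly {R : Type*} [CommRing R] [Algebra R ℂ] (p : MvPolynomial (Fin 3) R)
    (t : ℂ) : (aeval curvePoly p).eval t = aeval (conicMap (conicPoint t)) p := by
  rw [← funext (eval_curvePoly t)]
  induction p using MvPolynomial.induction_on with
  | C a => simp [Polynomial.algebraMap_apply]
  | add p q hp hq => simp [hp, hq]
  | mul_X p i hp => simp [hp]

theorem natDegree_aeval_curvePoly_le {R : Type*} [CommRing R] [Algebra R ℂ]
    {p : MvPolynomial (Fin 3) R} {n : ℕ} (hp : p.IsHomogeneous n) :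
    (aeval curvePoly p).natDegree ≤ n * 6 := by
  rw [← aeval_map_algebraMap ℂ]
  exact aeval_natDegree_le _ (hp.map _).totalDegree_le _ natDegree_curvePoly_le

theorem conicMap_conicPoint_ne_zero (t : ℂ) : conicMap (conicPoint t) ≠ 0 :=
  (conicPoint_isIsotropic t).conicMap_ne_zero (conicPoint_ne_zero t)

theorem conicMap_antipode {t : ℂ} (ht : t ≠ 0) :
    conicMap (conicPoint (antipode t)) =
      (-((star t) ^ 6)⁻¹) • star (conicMap (conicPoint t)) := by
  rw [conicPoint_antipode ht, conicMap_smul, conicMap_star]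
  congr 1
  ring

theorem antipode_ne_self {t : ℂ} (ht : t ≠ 0) : antipode t ≠ t := by
  intro h
  have e : t * star t = -1 := by
    nth_rewrite 1 [← h]
    simp [antipode, ht]
  simp [Complex.mul_conj, Complex.ext_iff] at e
  linarith [Complex.normSq_nonneg t]

theorem exists_conicPoint_orthogonal (k : Fin 10) :
    ∃ t : ℂ, t ≠ 0 ∧ cnode k ⬝ᵥ conicPoint t = 0 := by
  have h1 : -(node k 0 : ℂ) + Complex.I * node k 1 ≠ 0 := by
    fin_cases k <;> simp [node, Complex.ext_iff]
  have h2 : (node k 0 : ℂ) + Complex.I * node k 1 ≠ 0 := by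
    fin_cases k <;> simp [node, Complex.ext_iff]
  obtain ⟨s, hs⟩ := IsAlgClosed.exists_pow_nat_eq (discrim (-(node k 0 : ℂ) + Complex.I * node k 1)
    (2 * node k 2) ((node k 0 : ℂ) + Complex.I * node k 1)) two_pos
  obtain ⟨t, ht⟩ := exists_quadratic_eq_zero h1 ⟨s, by rw [← hs, sq]⟩
  refine ⟨t, ?_, ?_⟩
  · rintro rfl
    simp [h2] at ht
  · simp only [dotProduct, Fin.sum_univ_three, cnode, conicPoint]
    simp
    linear_combination ht

theorem eq_of_conicMap_eq_smul_cnode {k l : Fin 10} {t θ η : ℂ}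
    (hk : conicMap (conicPoint t) = θ • cnode k) (hl : conicMap (conicPoint t) = η • cnode l) :
    k = l := by
  by_contra hne
  have hθ : θ ≠ 0 := by
    rintro rfl
    exact conicMap_conicPoint_ne_zero t (by rw [hk, zero_smul])
  have h1 := (nodeCubic_isHomogeneous k).aeval_smul θ (cnode k)
  have h2 := (nodeCubic_isHomogeneous k).aeval_smul η (cnode l)
  rw [← hk, MvPolynomial.aeval_eq_eval, MvPolynomial.aeval_eq_eval] at h1
  rw [← hl, MvPolynomial.aeval_eq_eval, MvPolynomial.aeval_eq_eval] at h2
  simp [eval_nodeCubic, hne, h1, hθ] at h2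

/-- The twenty parameters mapped to the nodes come in antipodal pairs and are distinct. -/
theorem exists_points_over_nodes : ∃ a : Fin 10 → ℂ, (∀ k, a k ≠ 0) ∧
    (∀ k, ∃ θ : ℂ, θ ≠ 0 ∧ conicMap (conicPoint (a k)) = θ • cnode k) ∧
    Function.Injective fun x : Fin 10 × Bool => if x.2 then antipode (a x.1) else a x.1 := by
  choose a ha horth using exists_conicPoint_orthogonal
  have hθ : ∀ k, ∃ θ : ℂ, conicMap (conicPoint (a k)) = θ • cnode k := fun k =>
    (conicPoint_isIsotropic _).conicMap_eq_smul_node k (horth k)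
  have hθ' : ∀ x : Fin 10 × Bool, ∃ θ : ℂ, conicMap (conicPoint
      (if x.2 then antipode (a x.1) else a x.1)) = θ • cnode x.1 := by
    rintro ⟨k, b⟩
    obtain ⟨θ, h⟩ := hθ k
    cases b
    · exact ⟨θ, by simpa using h⟩
    · refine ⟨(-((star (a k)) ^ 6)⁻¹) * star θ, ?_⟩
      simp only [if_true]
      rw [conicMap_antipode (ha k), h, mul_smul]
      congr 1
      ext i
      simp [cnode]
  refine ⟨a, ha, fun k => ?_, ?_⟩
  · obtain ⟨θ, h⟩ := hθ k
    refine ⟨θ, ?_, h⟩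
    rintro rfl
    exact conicMap_conicPoint_ne_zero _ (by rw [h, zero_smul])
  · rintro x y hxy
    obtain ⟨θ, h1⟩ := hθ' x
    obtain ⟨η, h2⟩ := hθ' y
    simp only at hxy
    rw [hxy] at h1
    obtain ⟨k, b⟩ := x
    obtain ⟨l, c⟩ := y
    obtain rfl : k = l := eq_of_conicMap_eq_smul_cnode h1 h2
    cases b <;> cases c <;> simp [antipode_ne_self (ha _), (antipode_ne_self (ha _)).symm] at hxy ⊢

theorem exists_mul_eq_of_rank_one {B : Fin 3 → Fin 3 → Polynomial ℂ}
    (hB : ∀ i j k, B i i * B j k = B i j * B i k) (h0 : ∀ t, ∃ i j, (B i j).eval t ≠ 0) :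
    ∃ v : Fin 3 → Polynomial ℂ, ∀ i j, v i * v j = B i j := by
  have hdiag : ∀ t, ∃ i, (B i i).eval t ≠ 0 := by
    intro t
    obtain ⟨i, j, hij⟩ := h0 t
    refine ⟨i, fun hi => hij ?_⟩
    have := congrArg (Polynomial.eval t) (hB i j j)
    simpa [hi] using this
  obtain ⟨i₀, hi₀⟩ := hdiag 0
  have hne : B i₀ i₀ ≠ 0 := fun h => hi₀ (by simp [h])
  obtain ⟨w, hw⟩ : ∃ w, w ^ 2 = B i₀ i₀ := by
    refine exists_sq_eq_of_even_rootMultiplicity fun t => ?_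
    obtain ⟨i, hi⟩ := hdiag t
    have hine : B i i ≠ 0 := fun h => hi (by simp [h])
    have e := hB i₀ i i
    have hne' : B i₀ i * B i₀ i ≠ 0 := e ▸ mul_ne_zero hne hine
    have e' := congrArg (Polynomial.rootMultiplicity t) e
    rw [Polynomial.rootMultiplicity_mul (mul_ne_zero hne hine),
      Polynomial.rootMultiplicity_mul hne', Polynomial.rootMultiplicity_eq_zero hi] at e'
    exact ⟨_, e'⟩
  have hw0 : w ≠ 0 := by
    rintro rfl
    exact hne (by rw [← hw]; simp)
  have hdvd : ∀ j, w ∣ B i₀ j := fun j => by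
    rw [← UniqueFactorizationMonoid.pow_dvd_pow_iff_dvd two_ne_zero, hw, sq, ← hB]
    exact dvd_mul_right _ _
  choose v hv using hdvd
  refine ⟨v, fun i j => mul_left_cancel₀ (pow_ne_zero 2 hw0) ?_⟩
  have := hB i₀ i j
  rw [hv i, hv j, ← hw] at this
  rw [this]
  ring

theorem exists_reflect_antipode {p : Polynomial ℂ} {n : ℕ} (hp : p.natDegree ≤ n) :
    ∃ r : Polynomial ℂ, ∀ t, t ≠ 0 → r.eval t = t ^ n * star (p.eval (antipode t)) := by
  refine ⟨∑ m ∈ Finset.range (n + 1),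
    Polynomial.C (star (p.coeff m) * (-1) ^ m) * Polynomial.X ^ (n - m), fun t ht => ?_⟩
  rw [Polynomial.eval_eq_sum_range' (Nat.lt_succ_of_le hp), Polynomial.eval_finsetSum, star_sum,
    Finset.mul_sum]
  refine Finset.sum_congr rfl fun m hm => ?_
  have hmn : m ≤ n := Nat.lt_succ_iff.1 (Finset.mem_range.1 hm)
  obtain ⟨d, rfl⟩ := Nat.exists_eq_add_of_le hmn
  have e : t * star (antipode t) = -1 := by simp [antipode, ht]
  simp only [Polynomial.eval_mul, Polynomial.eval_C, Polynomial.eval_pow, Polynomial.eval_X, ← e,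
    star_mul', star_pow, Nat.add_sub_cancel_left]
  ring

theorem eq_of_eval_eq_of_ne_zero {p q : Polynomial ℂ}
    (h : ∀ t, t ≠ 0 → p.eval t = q.eval t) : p = q := by
  refine Polynomial.eq_of_infinite_eval_eq p q ?_
  exact (Set.finite_singleton (0 : ℂ)).infinite_compl.mono fun t ht => h t ht

theorem exists_sign_of_antipode {v : Fin 3 → Polynomial ℂ} (hd : ∀ i, (v i).natDegree ≤ 12)
    (h : ∀ i j t, t ≠ 0 → (v i * v j).eval (antipode t) =
      ((star t) ^ 24)⁻¹ * star ((v i * v j).eval t)) :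
    ∃ ε : ℂ, (ε = 1 ∨ ε = -1) ∧ ∀ i t, t ≠ 0 → (v i).eval (antipode t) =
      ε * ((star t) ^ 12)⁻¹ * star ((v i).eval t) := by
  choose r hr using fun i => exists_reflect_antipode (hd i)
  have hrv : ∀ i j, r i * r j = v i * v j := fun i j => eq_of_eval_eq_of_ne_zero fun t ht => by
    have := h i j t ht
    rw [Polynomial.eval_mul, ← star_inj] at this
    simp only [Polynomial.eval_mul, star_mul', star_inv₀, star_star, star_pow] at this
    rw [Polynomial.eval_mul, hr i t ht, hr j t ht]
    rw [show t ^ 12 * star ((v i).eval (antipode t)) * (t ^ 12 * star ((v j).eval (antipode t)))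
      = t ^ 24 * (star ((v i).eval (antipode t)) * star ((v j).eval (antipode t))) by ring, this,
      Polynomial.eval_mul, mul_inv_cancel_left₀ (pow_ne_zero _ ht)]
  have main : ∀ ε : ℂ, star ε = ε → (∀ i, r i = Polynomial.C ε * v i) → ∀ i t, t ≠ 0 →
      (v i).eval (antipode t) = ε * ((star t) ^ 12)⁻¹ * star ((v i).eval t) := by
    intro ε hε hrε i t ht
    have e := hr i t ht
    have ht' : star t ≠ 0 := by simpa using ht
    rw [hrε, Polynomial.eval_mul, Polynomial.eval_C, ← star_inj, star_mul', star_mul', star_star,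
      hε, star_pow] at e
    rw [mul_right_comm, e]
    field_simp
  by_cases hv : ∀ i, v i = 0
  · refine ⟨1, Or.inl rfl, fun i t _ => ?_⟩
    simp [hv]
  · push Not at hv
    obtain ⟨j, hj⟩ := hv
    rcases mul_self_eq_mul_self_iff.1 (hrv j j) with hjj | hjj
    · refine ⟨1, Or.inl rfl, main 1 (by simp) fun i => mul_right_cancel₀ hj ?_⟩
      have := hrv i j
      rw [hjj] at this
      simpa using this
    · refine ⟨-1, Or.inr rfl, main (-1) (by simp) fun i => mul_right_cancel₀ hj ?_⟩
      have := hrv i j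
      rw [hjj] at this
      simp
      linear_combination -this

theorem exists_twist {ε : ℂ} (hε : ε = 1 ∨ ε = -1) : ∃ l : Polynomial ℂ, l ≠ 0 ∧
    l.natDegree ≤ 6 ∧
    (∀ t, t ≠ 0 → l.eval (antipode t) = -ε * ((star t) ^ 6)⁻¹ * star (l.eval t)) ∧
    ∀ t θ k, conicMap (conicPoint t) = θ • cnode k →
      ∃ s : ℝ, 0 ≤ s ∧ l.eval t ^ 2 = θ ^ 2 * s := by
  rcases hε with rfl | rfl
  · refine ⟨curvePoly 0, fun h => ?_, natDegree_curvePoly_le 0, fun t ht => ?_, fun t θ k h => ?_⟩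
    · have := congrArg (Polynomial.eval 2) h
      rw [eval_curvePoly] at this
      simp [conicMap, conicPoint, mul_pow] at this
      norm_num at this
    · rw [eval_curvePoly, eval_curvePoly, conicMap_antipode ht]
      simp
    · refine ⟨node k 0 ^ 2, sq_nonneg _, ?_⟩
      rw [eval_curvePoly, h]
      simp [cnode, mul_pow]
  · refine ⟨Polynomial.C (3 * Complex.I) *
      ∏ i, (conicPoint (Polynomial.X : Polynomial ℂ)) i, fun h => ?_, ?_, fun t ht => ?_,
      fun t θ k h => ?_⟩
    · have := congrArg (Polynomial.eval 2) h
      simp [conicPoint, Fin.prod_univ_three] at this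
      norm_num [Complex.ext_iff] at this
    · simp [conicPoint, Fin.prod_univ_three]
      compute_degree
      norm_num
    · have e := conicPoint_antipode ht
      have e0 := congrFun e 0
      have e1 := congrFun e 1
      have e2 := congrFun e 2
      simp [conicPoint] at e0 e1 e2
      simp [conicPoint, Fin.prod_univ_three, e0, e1, e2]
      ring
    · refine ⟨∑ i, node k i ^ 2, Finset.sum_nonneg fun i _ => sq_nonneg _, ?_⟩
      have e := (conicPoint_isIsotropic t).conicMap_sq_sum
      have e' : (Polynomial.C (3 * Complex.I) *
          ∏ i, (conicPoint (Polynomial.X : Polynomial ℂ)) i).eval t =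
          3 * Complex.I * (conicPoint t 0 * conicPoint t 1 * conicPoint t 2) := by
        simp [conicPoint, Fin.prod_univ_three]
      rw [e', mul_pow, mul_pow, Complex.I_sq,
        show (3 : ℂ) ^ 2 * -1 = -9 by norm_num, ← e, h]
      simp [cnode, Fin.sum_univ_three]
      ring

theorem Complex.star_eq_self_of_sq_eq {e : ℂ} {s : ℝ} (hs : 0 ≤ s) (h : e ^ 2 = s) :
    star e = e := by
  have h1 : e ^ 2 = ((Real.sqrt s : ℝ) : ℂ) ^ 2 := by
    rw [h, ← Complex.ofReal_pow, Real.sq_sqrt hs]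
  rcases sq_eq_sq_iff_eq_or_eq_neg.1 h1 with h | h <;> simp [h]

/-- A section of degree `18` with real values at the nodes is the restriction of a cubic form. -/
theorem exists_cubic_aeval_curvePoly_eq {w : Polynomial ℂ} (hd : w.natDegree ≤ 18)
    (hanti : ∀ t, t ≠ 0 → w.eval (antipode t) = -((star t) ^ 18)⁻¹ * star (w.eval t))
    (hnode : ∀ t θ k, conicMap (conicPoint t) = θ • cnode k →
      ∃ s : ℝ, 0 ≤ s ∧ w.eval t ^ 2 = θ ^ 6 * s) :
    ∃ c : MvPolynomial (Fin 3) ℂ, c.IsHomogeneous 3 ∧ aeval curvePoly c = w := by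
  obtain ⟨a, ha, hθ, hinj⟩ := exists_points_over_nodes
  choose θ hθ0 hθ using hθ
  let e : Fin 10 → ℂ := fun k => w.eval (a k) / θ k ^ 3
  have he : ∀ k, star (e k) = e k := by
    intro k
    obtain ⟨s, hs, h⟩ := hnode _ _ k (hθ k)
    refine Complex.star_eq_self_of_sq_eq hs ?_
    have := hθ0 k
    simp only [e, div_pow, h]
    field_simp
  let c : MvPolynomial (Fin 3) ℂ := ∑ k, C (e k) * nodeCubic k
  have hc : c.IsHomogeneous 3 :=
    IsHomogeneous.sum _ _ _ fun k _ => (nodeCubic_isHomogeneous k).C_mul _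
  have hcn : ∀ k, eval (cnode k) c = e k := fun k => by
    simp [c, eval_nodeCubic]
  have hval : ∀ t η k, conicMap (conicPoint t) = η • cnode k →
      (aeval curvePoly c).eval t = η ^ 3 * e k := by
    intro t η k h
    rw [eval_aeval_curvePoly, h, hc.aeval_smul, MvPolynomial.aeval_eq_eval, hcn]
  refine ⟨c, hc, sub_eq_zero.1 ?_⟩
  refine Polynomial.eq_zero_of_natDegree_lt_card_of_eval_eq_zero _ hinj ?_ ?_
  · rintro ⟨k, b⟩
    have hw : w.eval (a k) = θ k ^ 3 * e k := by
      have := hθ0 k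
      simp only [e]
      field_simp
    cases b
    · simp [hval _ _ _ (hθ k), hw]
    · have h : conicMap (conicPoint (antipode (a k))) =
          (-((star (a k)) ^ 6)⁻¹ * star (θ k)) • cnode k := by
        rw [conicMap_antipode (ha k), hθ k, mul_smul]
        congr 1
        ext i
        simp [cnode]
      simp only [if_true, Polynomial.eval_sub]
      rw [hval _ _ _ h, hanti _ (ha k), hw, star_mul', star_pow, he]
      have : star (a k) ≠ 0 := by simpa using ha k
      field_simp
      ring
  · refine lt_of_le_of_lt (Polynomial.natDegree_sub_le_of_le
      (natDegree_aeval_curvePoly_le hc) hd) ?_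
    simp

theorem eq_zero_of_aeval_curvePoly_eq_zero {p : MvPolynomial (Fin 3) ℂ} (hp : p.IsHomogeneous 5)
    (h : aeval curvePoly p = 0) : p = 0 := by
  refine MvPolynomial.funext fun x => ?_
  rw [map_zero]
  refine eval_quintic_eq_zero hp (fun z hz hz2 => ?_) x
  obtain ⟨s, t, rfl⟩ := hz.exists_eq_smul_conicPoint hz2
  have e := eval_aeval_curvePoly p t
  rw [h, Polynomial.eval_zero] at e
  rw [conicMap_smul, ← MvPolynomial.aeval_eq_eval, hp.aeval_smul, ← e, mul_zero]

theorem robinson_ne_zero : Robinson ≠ 0 := by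
  intro h
  have := congrArg (eval ![1, 0, 0]) h
  simp [Robinson] at this

section

variable {M : Matrix (Fin 3) (Fin 3) (MvPolynomial (Fin 3) ℝ)}

theorem exists_adjugate_eval_conicPoint_ne_zero (hM : ∀ i j, (M i j).IsHomogeneous 2)
    (hdet : M.det = Robinson) (hpsd : ∀ a, (M.map (eval a)).PosSemidef) (t : ℂ) :
    ∃ i j, aeval (conicMap (conicPoint t)) (M.adjugate i j) ≠ 0 := by
  by_contra! h
  obtain ⟨k, hk⟩ := exists_node_of_pderiv_eq_zero (conicPoint_isIsotropic t)
    (conicPoint_ne_zero t) fun i => hdet ▸ aeval_pderiv_det_eq_zero M _ h i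
  obtain ⟨θ, hθ⟩ := (conicPoint_isIsotropic t).conicMap_eq_smul_node k hk
  obtain ⟨i, hi⟩ := adjugate_node_ne_zero hdet hpsd k
  have e := h i i
  rw [hθ, (adjugate_isHomogeneous hM i i).aeval_smul, aeval_cnode] at e
  rcases mul_eq_zero.1 e with e | e
  · rw [pow_eq_zero_iff four_ne_zero] at e
    exact conicMap_conicPoint_ne_zero t (by rw [hθ, e, zero_smul])
  · exact hi (by exact_mod_cast e)

theorem exists_kernel_on_curve (hsymm : M.IsSymm) (hM : ∀ i j, (M i j).IsHomogeneous 2)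
    (hdet : M.det = Robinson) (hpsd : ∀ a, (M.map (eval a)).PosSemidef) :
    ∃ v : Fin 3 → Polynomial ℂ, v ≠ 0 ∧ M.map (aeval curvePoly) *ᵥ v = 0 ∧
      ∀ i j, v i * v j = aeval curvePoly (M.adjugate i j) := by
  let N : Matrix (Fin 3) (Fin 3) (Polynomial ℂ) := M.map (aeval curvePoly)
  have hN : N.IsSymm := by
    ext i j
    simp [N, hsymm.apply i j]
  have hNdet : N.det = 0 := by
    have e : N.det = aeval curvePoly M.det := ((aeval curvePoly).map_det M).symm
    rw [e, hdet]
    exact (conicPoint_isIsotropic _).aeval_robinson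
  have hadj : ∀ i j, aeval curvePoly (M.adjugate i j) = N.adjugate i j :=
    Matrix.adjugate_map_apply M (aeval curvePoly : MvPolynomial (Fin 3) ℝ →ₐ[ℝ] _).toRingHom
  have hne : ∀ t, ∃ i j, (N.adjugate i j).eval t ≠ 0 := fun t => by
    obtain ⟨i, j, h⟩ := exists_adjugate_eval_conicPoint_ne_zero hM hdet hpsd t
    refine ⟨i, j, ?_⟩
    rwa [← hadj, eval_aeval_curvePoly]
  obtain ⟨v, hv⟩ := exists_mul_eq_of_rank_one
    (Matrix.adjugate_mul_adjugate_of_det_eq_zero hN hNdet) hne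
  have hv0 : v ≠ 0 := by
    rintro rfl
    obtain ⟨i, j, h⟩ := hne 0
    exact h (by simp [← hv])
  refine ⟨v, hv0, ?_, fun i j => by rw [hv, hadj]⟩
  obtain ⟨k, hk⟩ := Function.ne_iff.1 hv0
  ext1 i
  refine mul_right_cancel₀ hk ?_
  have e := congrFun (congrFun (Matrix.mul_adjugate N) i) k
  rw [hNdet, zero_smul, Matrix.mul_apply] at e
  simp only [Matrix.mulVec, dotProduct, Finset.sum_mul, mul_assoc, hv]
  simpa [N] using e

theorem exists_sections_on_curve (hsymm : M.IsSymm) (hM : ∀ i j, (M i j).IsHomogeneous 2)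
    (hdet : M.det = Robinson) (hpsd : ∀ a, (M.map (eval a)).PosSemidef) :
    ∃ c : Fin 3 → MvPolynomial (Fin 3) ℂ, c ≠ 0 ∧ (∀ j, (c j).IsHomogeneous 3) ∧
      M.map (aeval curvePoly) *ᵥ (fun j => aeval curvePoly (c j)) = 0 := by
  obtain ⟨v, hv0, hker, hv⟩ := exists_kernel_on_curve hsymm hM hdet hpsd
  have hA := adjugate_isHomogeneous hM
  have hdeg : ∀ i, (v i).natDegree ≤ 12 := fun i => by
    have h := natDegree_aeval_curvePoly_le (hA i i)
    rw [← hv, ← sq, Polynomial.natDegree_pow] at h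
    omega
  obtain ⟨ε, hε, hanti⟩ := exists_sign_of_antipode hdeg fun i j t ht => by
    rw [hv, eval_aeval_curvePoly, eval_aeval_curvePoly, conicMap_antipode ht,
      (hA i j).aeval_smul, aeval_star]
    ring
  obtain ⟨l, hl0, hldeg, hlanti, hlnode⟩ := exists_twist hε
  have hε2 : ε * ε = 1 := by rcases hε with rfl | rfl <;> simp
  have hcubic : ∀ j, ∃ c : MvPolynomial (Fin 3) ℂ, c.IsHomogeneous 3 ∧
      aeval curvePoly c = l * v j := by
    intro j
    refine exists_cubic_aeval_curvePoly_eq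
      (Polynomial.natDegree_mul_le_of_le hldeg (hdeg j)) (fun t ht => ?_) fun t θ k h => ?_
    · rw [Polynomial.eval_mul, Polynomial.eval_mul, hlanti t ht, hanti j t ht, star_mul']
      linear_combination (-((star t) ^ 6)⁻¹ * ((star t) ^ 12)⁻¹ * star (l.eval t)
        * star ((v j).eval t)) * hε2
    · obtain ⟨s, hs, hls⟩ := hlnode t θ k h
      have e := congrArg (Polynomial.eval t) (hv j j)
      rw [eval_aeval_curvePoly, h, (hA j j).aeval_smul, aeval_cnode, Polynomial.eval_mul] at e
      refine ⟨s * eval (node k) (M.adjugate j j), mul_nonneg hs ?_, ?_⟩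
      · have := (hpsd (node k)).adjugate_diag_nonneg j
        rwa [← Matrix.adjugate_map_apply] at this
      · rw [Polynomial.eval_mul, mul_pow, hls, sq ((v j).eval t), e]
        push_cast
        ring
  choose c hc hcv using hcubic
  refine ⟨c, ?_, hc, ?_⟩
  · rintro rfl
    refine hv0 (funext fun j => ?_)
    simpa [hl0] using (hcv j).symm
  · have : (fun j => aeval curvePoly (c j)) = l • v := funext hcv
    rw [this, Matrix.mulVec_smul, hker, smul_zero]

end

/-- The Robinson polynomial has no positive quadratic representation: there is no symmetric
`3 × 3` matrix `M` of real homogeneous quadratic forms with `det M = R` which is positive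
semidefinite at every real point. -/
theorem robinson_has_no_positive_quadratic_representation :
    ¬ ∃ M : Matrix (Fin 3) (Fin 3) (MvPolynomial (Fin 3) ℝ),
        M.IsSymm ∧ (∀ i j, (M i j).IsHomogeneous 2) ∧ M.det = Robinson ∧
        ∀ a : Fin 3 → ℝ, (M.map (MvPolynomial.eval a)).PosSemidef := by
  rintro ⟨M, hsymm, hM, hdet, hpsd⟩
  obtain ⟨c, hc0, hc, hker⟩ := exists_sections_on_curve hsymm hM hdet hpsd
  let f : MvPolynomial (Fin 3) ℝ →+* MvPolynomial (Fin 3) ℂ := map (algebraMap ℝ ℂ)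
  have hquintic : M.map f *ᵥ c = 0 := by
    ext1 i
    refine eq_zero_of_aeval_curvePoly_eq_zero ?_ ?_
    · exact IsHomogeneous.sum _ _ _ fun j _ => ((hM i j).map _).mul (hc j)
    · have e := congrFun hker i
      simpa [Matrix.mulVec, dotProduct, f, aeval_map_algebraMap] using e
  have hdet0 := Matrix.exists_mulVec_eq_zero_iff.1 ⟨c, hc0, hquintic⟩
  have e : (M.map f).det = f M.det := (f.map_det M).symm
  rw [e, hdet, map_eq_zero_iff f (map_injective _ (algebraMap ℝ ℂ).injective)] at hdet0
  exact robinson_ne_zero hdet0
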